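/- L² estimate for the density difference: under the hypotheses that (ρ, u), (ρ̄, ū) are smooth solutions of the continuity equation on 𝕋^d × [0,T] (d ≥ 3), with R = ρ − ρ̄ and U = u − ū, the following differential inequality holds: d/dt ‖R(t)‖_{L²} ≤ C ( (‖ρ(t)‖_∞ + ‖ρ̄(t)‖_∞) ‖∇U(t)‖_{L²} + ‖∇ū(t)‖_∞ ‖R(t)‖_{L²} + ‖∇ρ̄(t)‖_{L^d} ‖U(t)‖_{L^{2d/(d−2)}} ), with C depending only on d. -/

import Mathlib

open MeasureTheory RealInnerProductSpace

noncomputable section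

abbrev E (d : ℕ) := EuclideanSpace ℝ (Fin d)

/-- Fundamental domain of the torus `𝕋^d = ℝ^d / ℤ^d` (normalized volume 1). -/
def Q (d : ℕ) : Set (E d) := {x | ∀ i, x i ∈ Set.Ico (0 : ℝ) 1}

/-- `ℤ^d`-periodicity: a function on `ℝ^d` descending to the torus. -/
def Per {d : ℕ} {V : Type*} (f : E d → V) : Prop :=
  ∀ (x : E d) (k : Fin d → ℤ),
    f (x + (WithLp.equiv 2 (Fin d → ℝ)).symm fun i => (k i : ℝ)) = f x

def e (d : ℕ) (i : Fin d) : E d := EuclideanSpace.single i (1 : ℝ)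

/-- Divergence of a vector field. -/
def vdiv {d : ℕ} (u : E d → E d) (x : E d) : ℝ :=
  ∑ i, fderiv ℝ u x (e d i) i

/-- Componentwise Laplacian of a vector field. -/
def vlap {d : ℕ} (u : E d → E d) (x : E d) : E d :=
  ∑ i, fderiv ℝ (fun y => fderiv ℝ u y (e d i)) x (e d i)

/-- Squared Frobenius norm of the gradient of a vector field. -/
def gradsq {d : ℕ} (u : E d → E d) (x : E d) : ℝ :=
  ∑ i, ‖fderiv ℝ u x (e d i)‖ ^ 2

/-- The continuity equation `∂ₜρ + div(ρu) = 0` at time `t`, point `x`. -/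
def MassEq {d : ℕ} (ρ : ℝ → E d → ℝ) (u : ℝ → E d → E d) (t : ℝ) (x : E d) : Prop :=
  deriv (fun s => ρ s x) t + vdiv (fun y => ρ t y • u t y) x = 0

section Cube

variable {d : ℕ}

theorem isCompact_unitCube (d : ℕ) : IsCompact {x : E d | ∀ i, x i ∈ Set.Icc (0 : ℝ) 1} := by
  have h : {x : E d | ∀ i, x i ∈ Set.Icc (0 : ℝ) 1}
      = (WithLp.toLp 2) '' (Set.univ.pi fun _ : Fin d => Set.Icc (0 : ℝ) 1) := by
    ext x
    constructor
    · intro hx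
      exact ⟨x.ofLp, fun i _ => hx i, rfl⟩
    · rintro ⟨y, hy, rfl⟩ i
      exact hy i trivial
  rw [h]
  exact (isCompact_univ_pi fun _ => isCompact_Icc).image (PiLp.continuous_toLp 2 _)

theorem Q_subset_unitCube (d : ℕ) : Q d ⊆ {x : E d | ∀ i, x i ∈ Set.Icc (0 : ℝ) 1} :=
  fun _ hx i => Set.Ico_subset_Icc_self (hx i)

theorem measurableSet_Q (d : ℕ) : MeasurableSet (Q d) := by
  have h : Q d = ⋂ i, (fun x : E d => x i) ⁻¹' Set.Ico (0 : ℝ) 1 := by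
    ext x
    simp [Q]
  rw [h]
  exact MeasurableSet.iInter fun i =>
    (by fun_prop : Continuous fun x : E d => x i).measurable measurableSet_Ico

instance isFiniteMeasure_restrict_Q (d : ℕ) :
    IsFiniteMeasure ((volume : Measure (E d)).restrict (Q d)) :=
  ⟨by
    rw [Measure.restrict_apply_univ]
    exact (measure_mono (Q_subset_unitCube d)).trans_lt (isCompact_unitCube d).measure_lt_top⟩

theorem Continuous.memLp_Q {V : Type*} [NormedAddCommGroup V] {f : E d → V}
    (hf : Continuous f) (p : ENNReal) : MemLp f p (volume.restrict (Q d)) := by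
  obtain ⟨C, hC⟩ := (isCompact_unitCube d).exists_bound_of_continuousOn hf.continuousOn
  refine MemLp.of_bound hf.aestronglyMeasurable C ?_
  filter_upwards [ae_restrict_mem (measurableSet_Q d)] with x hx
  exact hC x (Q_subset_unitCube d hx)

theorem Continuous.integrableOn_Q {V : Type*} [NormedAddCommGroup V] {f : E d → V}
    (hf : Continuous f) : IntegrableOn f (Q d) :=
  memLp_one_iff_integrable.1 (hf.memLp_Q 1)

/-- A continuous periodic function is bounded. -/
theorem Per.exists_bound {V : Type*} [NormedAddCommGroup V] {f : E d → V} (hp : Per f)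
    (hf : Continuous f) : ∃ C, ∀ x, ‖f x‖ ≤ C := by
  obtain ⟨C, hC⟩ := (isCompact_unitCube d).exists_bound_of_continuousOn hf.continuousOn
  refine ⟨C, fun x => ?_⟩
  have h := hp x fun i => -⌊x i⌋
  rw [← h]
  refine hC _ fun i => ?_
  have hi : (x + (WithLp.equiv 2 (Fin d → ℝ)).symm fun i => ((-⌊x i⌋ : ℤ) : ℝ)) i
      = Int.fract (x i) := by
    simp [Int.fract, sub_eq_add_neg]
  rw [hi]
  exact ⟨Int.fract_nonneg _, (Int.fract_lt_one _).le⟩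

theorem Per.bddAbove_range {f : E d → ℝ} (hp : Per f) (hf : Continuous f) :
    BddAbove (Set.range f) := by
  obtain ⟨C, hC⟩ := hp.exists_bound hf
  exact ⟨C, by rintro _ ⟨x, rfl⟩; exact (le_abs_self _).trans (hC x)⟩

theorem Per.fderiv {V : Type*} [NormedAddCommGroup V] [NormedSpace ℝ V] {f : E d → V}
    (hp : Per f) : Per (fderiv ℝ f) := by
  intro x k
  rw [← fderiv_comp_add_right]
  congr 1
  funext y
  exact hp y k

/-- Hölder inequality on the cube for nonnegative continuous functions. -/
theorem setIntegral_Q_mul_le_Lp_mul_Lq {p q : ℝ} (hpq : p.HolderConjugate q) {f g : E d → ℝ}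
    (hf : Continuous f) (hg : Continuous g) (hf0 : ∀ x, 0 ≤ f x) (hg0 : ∀ x, 0 ≤ g x) :
    ∫ x in Q d, f x * g x
      ≤ (∫ x in Q d, f x ^ p) ^ (1 / p) * (∫ x in Q d, g x ^ q) ^ (1 / q) :=
  integral_mul_le_Lp_mul_Lq_of_nonneg hpq (.of_forall hf0) (.of_forall hg0)
    (hf.memLp_Q _) (hg.memLp_Q _)

theorem setIntegral_Q_mul_le_L2_mul_L2 {f g : E d → ℝ}
    (hf : Continuous f) (hg : Continuous g) :
    ∫ x in Q d, |f x| * |g x|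
      ≤ (∫ x in Q d, f x ^ 2) ^ (1 / 2 : ℝ) * (∫ x in Q d, g x ^ 2) ^ (1 / 2 : ℝ) := by
  have h := setIntegral_Q_mul_le_Lp_mul_Lq (d := d) Real.HolderConjugate.two_two hf.abs hg.abs
    (fun _ => abs_nonneg _) (fun _ => abs_nonneg _)
  simpa [Real.rpow_two, sq_abs] using h

/-- Generalized Hölder inequality with exponents `2`, `n` and `2 * n / (n - 2)`. -/
theorem setIntegral_Q_mul_mul_le {n : ℕ} (hd : 3 ≤ n) {f g h : E d → ℝ} (hf : Continuous f)
    (hg : Continuous g) (hh : Continuous h) (hg0 : ∀ x, 0 ≤ g x) (hh0 : ∀ x, 0 ≤ h x) :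
    ∫ x in Q d, |f x| * (g x * h x)
      ≤ (∫ x in Q d, f x ^ 2) ^ (1 / 2 : ℝ) * ((∫ x in Q d, g x ^ (n : ℝ)) ^ (1 / (n : ℝ))
        * (∫ x in Q d, h x ^ (2 * (n : ℝ) / ((n : ℝ) - 2))) ^ (((n : ℝ) - 2) / (2 * (n : ℝ)))) := by
  have hn : (3 : ℝ) ≤ n := by exact_mod_cast hd
  have hn2 : (n : ℝ) - 2 ≠ 0 := by linarith
  have hn0 : (n : ℝ) ≠ 0 := by linarith
  have h1 := setIntegral_Q_mul_le_L2_mul_L2 hf (hg.mul hh)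
  simp only [Pi.mul_apply, abs_mul, fun x => abs_of_nonneg (hg0 x),
    fun x => abs_of_nonneg (hh0 x), mul_pow] at h1
  refine h1.trans ?_
  gcongr ?_ * ?_
  have hpq : ((n : ℝ) / 2).HolderConjugate ((n : ℝ) / ((n : ℝ) - 2)) := by
    rw [Real.holderConjugate_iff]
    refine ⟨by linarith, ?_⟩
    field_simp
    ring
  have h2 := setIntegral_Q_mul_le_Lp_mul_Lq (d := d) hpq (hg.pow 2) (hh.pow 2)
    (fun x => sq_nonneg _) (fun x => sq_nonneg _)
  have hgp : ∀ x, (g x ^ 2) ^ ((n : ℝ) / 2) = g x ^ (n : ℝ) := fun x => by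
    rw [← Real.rpow_two, ← Real.rpow_mul (hg0 x)]
    congr 1
    ring
  have hhp : ∀ x, (h x ^ 2) ^ ((n : ℝ) / ((n : ℝ) - 2)) = h x ^ (2 * (n : ℝ) / ((n : ℝ) - 2)) :=
    fun x => by
      rw [← Real.rpow_two, ← Real.rpow_mul (hh0 x)]
      congr 1
      ring
  simp only [Pi.pow_apply, hgp, hhp] at h2
  have hA : 0 ≤ ∫ x in Q d, g x ^ (n : ℝ) := integral_nonneg fun x => Real.rpow_nonneg (hg0 x) _
  have hB : 0 ≤ ∫ x in Q d, h x ^ (2 * (n : ℝ) / ((n : ℝ) - 2)) :=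
    integral_nonneg fun x => Real.rpow_nonneg (hh0 x) _
  have h3 := Real.rpow_le_rpow (integral_nonneg fun x => by positivity) h2
    (by norm_num : (0 : ℝ) ≤ 1 / 2)
  rw [Real.mul_rpow (by positivity) (by positivity), ← Real.rpow_mul hA, ← Real.rpow_mul hB] at h3
  have e1 : 1 / ((n : ℝ) / 2) * (1 / 2) = 1 / (n : ℝ) := by field_simp
  have e2 : 1 / ((n : ℝ) / ((n : ℝ) - 2)) * (1 / 2) = ((n : ℝ) - 2) / (2 * (n : ℝ)) := by
    field_simp
  rw [e1, e2] at h3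
  exact h3

end Cube

section Divergence

variable {d : ℕ}

/-- The integral over the torus of the divergence of a `C¹` periodic vector field vanishes. -/
theorem setIntegral_Q_vdiv_eq_zero {F : E d → E d} (hF : ContDiff ℝ 1 F) (hp : Per F) :
    ∫ x in Q d, vdiv F x = 0 := by
  rcases d with _ | n
  · simp [vdiv]
  let L : (Fin (n + 1) → ℝ) ≃L[ℝ] E (n + 1) :=
    (PiLp.continuousLinearEquiv 2 ℝ fun _ : Fin (n + 1) => ℝ).symm
  have hcont : Continuous fun y : Fin (n + 1) → ℝ => vdiv F (L y) := by
    have := hF.continuous_fderiv one_ne_zero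
    unfold vdiv
    fun_prop
  have hpre : L ⁻¹' Q (n + 1) = Set.univ.pi fun _ => Set.Ico (0 : ℝ) 1 := by
    ext y
    simp [Q, L]
  have hmp : MeasurePreserving L := PiLp.volume_preserving_toLp (Fin (n + 1))
  rw [← hmp.setIntegral_preimage_emb L.toHomeomorph.measurableEmbedding, hpre, volume_pi,
    setIntegral_congr_set Measure.univ_pi_Ico_ae_eq_Icc, ← volume_pi]
  have key := integral_divergence_of_hasFDerivAt_off_countable'
    (fun _ : Fin (n + 1) => (0 : ℝ)) (fun _ => 1) (fun _ => zero_le_one)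
    (fun i y => F (L y) i)
    (fun i y => (EuclideanSpace.proj i).comp ((fderiv ℝ F (L y)).comp L.toContinuousLinearMap))
    ∅ Set.countable_empty (fun i => by have := hF.continuous; fun_prop)
    (fun y _ i => by
      have h1 : HasFDerivAt F (fderiv ℝ F (L y)) (L y) :=
        (hF.differentiable one_ne_zero _).hasFDerivAt
      exact (EuclideanSpace.proj (𝕜 := ℝ) i).hasFDerivAt.comp y (h1.comp y L.hasFDerivAt))
    (hcont.integrableOn_Icc)
  refine Eq.trans ?_ (key.trans ?_)
  · rfl
  refine Finset.sum_eq_zero fun i _ => ?_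
  rw [sub_eq_zero]
  refine integral_congr_ae (.of_forall fun y => ?_)
  have h := hp (L (i.insertNth 0 y)) (Pi.single i 1)
  have h2 : L (i.insertNth 0 y) + (WithLp.equiv 2 (Fin (n + 1) → ℝ)).symm
      (fun j => ((Pi.single i 1 : Fin (n + 1) → ℤ) j : ℝ)) = L (i.insertNth 1 y) := by
    ext j
    refine Fin.succAboveCases i ?_ (fun j => ?_) j <;> simp [L]
  rw [h2] at h
  exact congrArg (fun v : E (n + 1) => v i) h

theorem fderiv_apply_eq_sum (A : E d →L[ℝ] ℝ) (v : E d) : A v = ∑ i, A (e d i) * v i := by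
  have hv : v = ∑ i, v i • e d i := by
    ext j
    simp [e, Pi.single_apply]
  conv_lhs => rw [hv]
  simp [mul_comm]

theorem vdiv_smul {f : E d → ℝ} {v : E d → E d} {x : E d} (hf : DifferentiableAt ℝ f x)
    (hv : DifferentiableAt ℝ v x) :
    vdiv (fun y => f y • v y) x = f x * vdiv v x + fderiv ℝ f x (v x) := by
  unfold vdiv
  rw [fderiv_fun_smul hf hv, fderiv_apply_eq_sum (fderiv ℝ f x), Finset.mul_sum,
    ← Finset.sum_add_distrib]
  simp

theorem vdiv_sub {v w : E d → E d} {x : E d} (hv : DifferentiableAt ℝ v x)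
    (hw : DifferentiableAt ℝ w x) :
    vdiv (fun y => v y - w y) x = vdiv v x - vdiv w x := by
  unfold vdiv
  rw [fderiv_fun_sub hv hw, ← Finset.sum_sub_distrib]
  simp

theorem continuous_vdiv {v : E d → E d} (hv : ContDiff ℝ 1 v) : Continuous (vdiv v) := by
  have := hv.continuous_fderiv one_ne_zero
  unfold vdiv
  fun_prop

theorem continuous_gradsq {v : E d → E d} (hv : ContDiff ℝ 1 v) : Continuous (gradsq v) := by
  have := hv.continuous_fderiv one_ne_zero
  unfold gradsq
  fun_prop

theorem sq_vdiv_le (v : E d → E d) (x : E d) : vdiv v x ^ 2 ≤ d * gradsq v x := by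
  refine (sq_sum_le_card_mul_sum_sq).trans ?_
  simp only [Finset.card_univ, Fintype.card_fin, gradsq]
  refine mul_le_mul_of_nonneg_left (Finset.sum_le_sum fun i _ => ?_) (Nat.cast_nonneg d)
  exact sq_le_sq.2 ((PiLp.norm_apply_le (fderiv ℝ v x (e d i)) i).trans (le_abs_self _))

theorem abs_vdiv_le (v : E d → E d) (x : E d) : |vdiv v x| ≤ d * ‖fderiv ℝ v x‖ := by
  refine (Finset.abs_sum_le_sum_abs _ _).trans ?_
  have h : ∀ i ∈ Finset.univ, |fderiv ℝ v x (e d i) i| ≤ ‖fderiv ℝ v x‖ := fun i _ => by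
    refine (PiLp.norm_apply_le (fderiv ℝ v x (e d i)) i).trans ?_
    simpa [e] using (fderiv ℝ v x).le_opNorm (e d i)
  simpa using Finset.sum_le_card_nsmul _ _ _ h

end Divergence

section EnergyEstimate

variable {d : ℕ}

theorem mul_vdiv_smul_sub_vdiv_smul {r s : E d → ℝ} {a b : E d → E d} {x : E d}
    (hr : DifferentiableAt ℝ r x) (hs : DifferentiableAt ℝ s x)
    (ha : DifferentiableAt ℝ a x) (hb : DifferentiableAt ℝ b x) :
    (r x - s x) * (vdiv (fun y => r y • a y) x - vdiv (fun y => s y • b y) x)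
      = vdiv (fun y => ((r y - s y) ^ 2 / 2) • a y) x
        + (r x + s x) / 2 * ((r x - s x) * vdiv (fun y => a y - b y) x)
        + 1 / 2 * ((r x - s x) ^ 2 * vdiv b x)
        + (r x - s x) * fderiv ℝ s x (a x - b x) := by
  have h : HasFDerivAt (fun y => (r y - s y) ^ 2 / 2)
      ((r x - s x) • (fderiv ℝ r x - fderiv ℝ s x)) x := by
    have h := ((hr.hasFDerivAt.sub hs.hasFDerivAt).pow 2).mul_const (1 / 2 : ℝ)
    refine (h.congr_fderiv ?_).congr_of_eventuallyEq (.of_forall fun y => ?_)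
    · ext v
      simp
      ring
    · simp [div_eq_mul_inv]
  rw [vdiv_smul hr ha, vdiv_smul hs hb, vdiv_smul h.differentiableAt ha, vdiv_sub ha hb,
    h.fderiv, map_sub]
  simp only [smul_apply, sub_apply, smul_eq_mul]
  ring

theorem abs_fderiv_apply_le_norm_gradient (s : E d → ℝ) (x v : E d) :
    |fderiv ℝ s x v| ≤ ‖gradient s x‖ * ‖v‖ := by
  have h : ‖gradient s x‖ = ‖fderiv ℝ s x‖ := by simp [gradient]
  rw [h]
  exact (fderiv ℝ s x).le_opNorm v

/-- The energy estimate at a fixed time, for two densities `r`, `s` transported by `a`, `b`. -/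
theorem neg_setIntegral_Q_mul_vdiv_le (hd : 3 ≤ d) {r s : E d → ℝ} {a b : E d → E d}
    (hr : ContDiff ℝ 1 r) (hs : ContDiff ℝ 1 s) (ha : ContDiff ℝ 1 a) (hb : ContDiff ℝ 1 b)
    (hpr : Per r) (hps : Per s) (hpa : Per a) (hpb : Per b)
    (hr0 : ∀ x, 0 ≤ r x) (hs0 : ∀ x, 0 ≤ s x) :
    -∫ x in Q d, (r x - s x) * (vdiv (fun y => r y • a y) x - vdiv (fun y => s y • b y) x)
      ≤ d * (((⨆ x, r x) + (⨆ x, s x))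
              * (∫ x in Q d, gradsq (fun y => a y - b y) x) ^ (1 / 2 : ℝ)
            + (⨆ x, ‖fderiv ℝ b x‖) * (∫ x in Q d, (r x - s x) ^ 2) ^ (1 / 2 : ℝ)
            + (∫ x in Q d, ‖gradient s x‖ ^ (d : ℝ)) ^ (1 / (d : ℝ))
              * (∫ x in Q d, ‖a x - b x‖ ^ (2 * (d : ℝ) / ((d : ℝ) - 2)))
                  ^ (((d : ℝ) - 2) / (2 * (d : ℝ))))
          * (∫ x in Q d, (r x - s x) ^ 2) ^ (1 / 2 : ℝ) := by
  have hd1 : (1 : ℝ) ≤ d := by exact_mod_cast (by omega : 1 ≤ d)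
  have hrc := hr.continuous
  have hsc := hs.continuous
  have hac := ha.continuous
  have hbc := hb.continuous
  have hR : Continuous fun x => r x - s x := hrc.sub hsc
  have hU : ContDiff ℝ 1 fun y => a y - b y := ha.sub hb
  have hdU := continuous_vdiv hU
  have hds := hs.continuous_fderiv one_ne_zero
  have hdbn : Continuous fun x => ‖fderiv ℝ b x‖ := (hb.continuous_fderiv one_ne_zero).norm
  have hgs : Continuous fun x => ‖gradient s x‖ := by
    simpa [gradient] using hds.norm
  have hF : ContDiff ℝ 1 fun y => ((r y - s y) ^ 2 / 2) • a y :=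
    (((hr.sub hs).pow 2).div_const 2).smul ha
  have hpF : Per fun y => ((r y - s y) ^ 2 / 2) • a y := fun x k => by
    simp only [hpr x k, hps x k, hpa x k]
  set M := (⨆ x, r x) + (⨆ x, s x)
  set B := ⨆ x, ‖fderiv ℝ b x‖
  set N := (∫ x in Q d, (r x - s x) ^ 2) ^ (1 / 2 : ℝ) with hN
  set G := (∫ x in Q d, gradsq (fun y => a y - b y) x) ^ (1 / 2 : ℝ)
  set H := (∫ x in Q d, ‖gradient s x‖ ^ (d : ℝ)) ^ (1 / (d : ℝ))
    * (∫ x in Q d, ‖a x - b x‖ ^ (2 * (d : ℝ) / ((d : ℝ) - 2))) ^ (((d : ℝ) - 2) / (2 * (d : ℝ)))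
  have hI0 : 0 ≤ ∫ x in Q d, (r x - s x) ^ 2 := integral_nonneg fun x => sq_nonneg _
  have hG00 : 0 ≤ ∫ x in Q d, gradsq (fun y => a y - b y) x :=
    integral_nonneg fun x => Finset.sum_nonneg fun i _ => sq_nonneg _
  have hN0 : 0 ≤ N := Real.rpow_nonneg hI0 _
  have hG0 : 0 ≤ G := Real.rpow_nonneg hG00 _
  have hH0 : 0 ≤ H := by positivity
  have hNN : N * N = ∫ x in Q d, (r x - s x) ^ 2 := by
    rw [hN, ← Real.sqrt_eq_rpow, Real.mul_self_sqrt hI0]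
  have hM : ∀ x, r x + s x ≤ M := fun x =>
    add_le_add (le_ciSup (hpr.bddAbove_range hrc) x) (le_ciSup (hps.bddAbove_range hsc) x)
  have hM0 : 0 ≤ M := (add_nonneg (hr0 0) (hs0 0)).trans (hM 0)
  have hB : ∀ x, ‖fderiv ℝ b x‖ ≤ B := fun x => by
    refine le_ciSup (f := fun x => ‖fderiv ℝ b x‖) (Per.bddAbove_range (fun x k => ?_) hdbn) x
    rw [hpb.fderiv x k]
  have hB0 : 0 ≤ B := (norm_nonneg _).trans (hB 0)
  have h1 : ∫ x in Q d, |r x - s x| * |vdiv (fun y => a y - b y) x| ≤ N * (d * G) := by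
    refine (setIntegral_Q_mul_le_L2_mul_L2 hR hdU).trans ?_
    gcongr
    calc (∫ x in Q d, vdiv (fun y => a y - b y) x ^ 2) ^ (1 / 2 : ℝ)
        ≤ ((d : ℝ) ^ 2 * ∫ x in Q d, gradsq (fun y => a y - b y) x) ^ (1 / 2 : ℝ) := by
          refine Real.rpow_le_rpow (integral_nonneg fun x => sq_nonneg _) ?_ (by norm_num)
          rw [← integral_const_mul]
          refine integral_mono (hdU.pow 2).integrableOn_Q
            (continuous_const.mul (continuous_gradsq hU)).integrableOn_Q fun x => ?_
          refine (sq_vdiv_le _ x).trans ?_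
          have : 0 ≤ gradsq (fun y => a y - b y) x := Finset.sum_nonneg fun i _ => sq_nonneg _
          gcongr
          nlinarith
      _ = d * G := by
          rw [Real.mul_rpow (by positivity) hG00, ← Real.sqrt_eq_rpow,
            Real.sqrt_sq (by positivity)]
  have h3 : ∫ x in Q d, |r x - s x| * (‖gradient s x‖ * ‖a x - b x‖) ≤ N * H :=
    setIntegral_Q_mul_mul_le hd hR hgs (hac.sub hbc).norm (fun _ => norm_nonneg _)
      (fun _ => norm_nonneg _)
  have i1 : IntegrableOn (fun x => |r x - s x| * |vdiv (fun y => a y - b y) x|) (Q d) :=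
    (hR.abs.mul hdU.abs).integrableOn_Q
  have i2 : IntegrableOn (fun x => (r x - s x) ^ 2) (Q d) := (hR.pow 2).integrableOn_Q
  have i3 : IntegrableOn (fun x => |r x - s x| * (‖gradient s x‖ * ‖a x - b x‖)) (Q d) :=
    (hR.abs.mul (hgs.mul (hac.sub hbc).norm)).integrableOn_Q
  have i4 : IntegrableOn (fun x => vdiv (fun y => ((r y - s y) ^ 2 / 2) • a y) x) (Q d) :=
    (continuous_vdiv hF).integrableOn_Q
  have j2 : IntegrableOn (fun x => M * (|r x - s x| * |vdiv (fun y => a y - b y) x|)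
      + d * B * (r x - s x) ^ 2) (Q d) := (i1.const_mul M).add (i2.const_mul (d * B))
  have j3 : IntegrableOn (fun x => M * (|r x - s x| * |vdiv (fun y => a y - b y) x|)
      + d * B * (r x - s x) ^ 2 + |r x - s x| * (‖gradient s x‖ * ‖a x - b x‖)) (Q d) :=
    j2.add i3
  have hle : -∫ x in Q d,
        (r x - s x) * (vdiv (fun y => r y • a y) x - vdiv (fun y => s y • b y) x)
      ≤ ∫ x in Q d, (M * (|r x - s x| * |vdiv (fun y => a y - b y) x|)
          + d * B * (r x - s x) ^ 2 + |r x - s x| * (‖gradient s x‖ * ‖a x - b x‖)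
          - vdiv (fun y => ((r y - s y) ^ 2 / 2) • a y) x) := by
    rw [← integral_neg]
    refine integral_mono ((hR.mul ((continuous_vdiv (hr.smul ha)).sub
      (continuous_vdiv (hs.smul hb)))).neg.integrableOn_Q)
      (j3.sub i4) fun x => ?_
    beta_reduce
    rw [mul_vdiv_smul_sub_vdiv_smul (hr.differentiable one_ne_zero x)
      (hs.differentiable one_ne_zero x) (ha.differentiable one_ne_zero x)
      (hb.differentiable one_ne_zero x)]
    have e1 : -((r x + s x) / 2 * ((r x - s x) * vdiv (fun y => a y - b y) x))
        ≤ M * (|r x - s x| * |vdiv (fun y => a y - b y) x|) := by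
      refine (neg_le_abs _).trans ?_
      rw [abs_mul, abs_mul (r x - s x),
        abs_of_nonneg (by linarith [hr0 x, hs0 x] : 0 ≤ (r x + s x) / 2)]
      gcongr
      linarith [hM x, hr0 x, hs0 x]
    have e2 : -(1 / 2 * ((r x - s x) ^ 2 * vdiv b x)) ≤ d * B * (r x - s x) ^ 2 := by
      have hv : |vdiv b x| ≤ d * B := (abs_vdiv_le b x).trans (by gcongr; exact hB x)
      nlinarith [abs_le.1 hv, sq_nonneg (r x - s x), abs_nonneg (vdiv b x)]
    have e3 : -((r x - s x) * fderiv ℝ s x (a x - b x))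
        ≤ |r x - s x| * (‖gradient s x‖ * ‖a x - b x‖) := by
      refine (neg_le_abs _).trans ?_
      rw [abs_mul]
      gcongr
      exact abs_fderiv_apply_le_norm_gradient s x _
    linarith
  refine hle.trans ?_
  rw [integral_sub j3 i4, integral_add j2 i3,
    integral_add (i1.const_mul M) (i2.const_mul (d * B)), integral_const_mul, integral_const_mul,
    setIntegral_Q_vdiv_eq_zero hF hpF, ← hNN]
  have h4 : N * H ≤ d * (N * H) := le_mul_of_one_le_left (by positivity) hd1
  have h5 := mul_le_mul_of_nonneg_left h1 hM0
  linarith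

/-- Differentiation under the integral sign over the cube. -/
theorem hasDerivAt_setIntegral_Q {f : ℝ → E d → ℝ}
    (hf : ContDiff ℝ 1 fun p : ℝ × E d => f p.1 p.2) (t : ℝ) :
    HasDerivAt (fun s => ∫ x in Q d, f s x) (∫ x in Q d, deriv (fun s => f s x) t) t := by
  have hderiv : ∀ s x, HasDerivAt (fun s => f s x)
      (fderiv ℝ (fun p : ℝ × E d => f p.1 p.2) (s, x) (1, 0)) s := fun s x =>
    HasFDerivAt.comp_hasDerivAt (f := fun s => (s, x)) s
      (hf.differentiable one_ne_zero (s, x)).hasFDerivAt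
      ((hasDerivAt_id s).prodMk (hasDerivAt_const s x))
  have hc : Continuous fun p : ℝ × E d => fderiv ℝ (fun p : ℝ × E d => f p.1 p.2) p (1, 0) :=
    (hf.continuous_fderiv one_ne_zero).clm_apply continuous_const
  obtain ⟨C, hC⟩ := ((isCompact_Icc (a := t - 1) (b := t + 1)).prod
    (isCompact_unitCube d)).exists_bound_of_continuousOn hc.continuousOn
  simp only [fun x => (hderiv t x).deriv]
  refine (hasDerivAt_integral_of_dominated_loc_of_deriv_le (bound := fun _ => C)
    (F' := fun s x => fderiv ℝ (fun p : ℝ × E d => f p.1 p.2) (s, x) (1, 0))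
    (Icc_mem_nhds (by linarith : t - 1 < t) (by linarith : t < t + 1))
    (.of_forall fun s => ?_) ?_ ?_ ?_ (integrable_const C) ?_).2
  · exact (hf.continuous.comp (Continuous.prodMk_right s)).aestronglyMeasurable
  · exact (hf.continuous.comp (Continuous.prodMk_right t)).integrableOn_Q
  · exact (hc.comp (Continuous.prodMk_right t)).aestronglyMeasurable
  · filter_upwards [ae_restrict_mem (measurableSet_Q d)] with x hx s hs
    exact hC (s, x) ⟨hs, Q_subset_unitCube d hx⟩
  · exact .of_forall fun x s _ => hderiv s x

end EnergyEstimate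

/-- Lemma 4.1: `d/dt ‖R‖₂ ≤ C((‖ρ‖_∞+‖ρ̄‖_∞)‖∇U‖₂ + ‖∇ū‖_∞‖R‖₂ + ‖∇ρ̄‖_d ‖U‖_{2d/(d−2)})`. -/
theorem density_difference_L2_estimate (d : ℕ) (hd : 3 ≤ d) :
    ∃ C > 0, ∀ (T : ℝ), 0 < T → ∀ (ρ ρbar : ℝ → E d → ℝ) (u ubar : ℝ → E d → E d),
      ContDiff ℝ (⊤ : ℕ∞) (fun p : ℝ × E d => ρ p.1 p.2) →
      ContDiff ℝ (⊤ : ℕ∞) (fun p : ℝ × E d => ρbar p.1 p.2) →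
      ContDiff ℝ (⊤ : ℕ∞) (fun p : ℝ × E d => u p.1 p.2) →
      ContDiff ℝ (⊤ : ℕ∞) (fun p : ℝ × E d => ubar p.1 p.2) →
      (∀ t ∈ Set.Icc 0 T, Per (ρ t) ∧ Per (ρbar t) ∧ Per (u t) ∧ Per (ubar t)) →
      (∀ t ∈ Set.Icc 0 T, ∀ x, 0 ≤ ρ t x ∧ 0 ≤ ρbar t x) →
      (∀ t ∈ Set.Icc 0 T, ∀ x, MassEq ρ u t x) →
      (∀ t ∈ Set.Icc 0 T, ∀ x, MassEq ρbar ubar t x) →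
      ∀ t ∈ Set.Icc 0 T,
        deriv (fun s => (∫ x in Q d, (ρ s x - ρbar s x) ^ 2) ^ (1 / 2 : ℝ)) t
          ≤ C * (((⨆ x, ρ t x) + (⨆ x, ρbar t x))
                  * (∫ x in Q d, gradsq (fun y => u t y - ubar t y) x) ^ (1 / 2 : ℝ)
              + (⨆ x, ‖fderiv ℝ (ubar t) x‖)
                  * (∫ x in Q d, (ρ t x - ρbar t x) ^ 2) ^ (1 / 2 : ℝ)
              + (∫ x in Q d, ‖gradient (ρbar t) x‖ ^ (d : ℝ)) ^ (1 / (d : ℝ))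
                  * (∫ x in Q d, ‖u t x - ubar t x‖ ^ (2 * (d : ℝ) / ((d : ℝ) - 2)))
                      ^ (((d : ℝ) - 2) / (2 * (d : ℝ)))) := by
  refine ⟨d, by exact_mod_cast (by omega : 0 < d), ?_⟩
  intro T _ ρ ρbar u ubar hρ hρb hu hub hper hpos hm hmb t ht
  obtain ⟨hpr, hps, hpa, hpb⟩ := hper t ht
  have hslice : ContDiff ℝ 1 fun x : E d => (t, x) := contDiff_prodMk_right t
  have one_le : (1 : WithTop ℕ∞) ≤ ((⊤ : ℕ∞) : WithTop ℕ∞) := by exact_mod_cast le_top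
  replace hρ := hρ.of_le one_le
  replace hρb := hρb.of_le one_le
  have hr : ContDiff ℝ 1 (ρ t) := hρ.comp hslice
  have hs : ContDiff ℝ 1 (ρbar t) := hρb.comp hslice
  have ha : ContDiff ℝ 1 (u t) := (hu.of_le one_le).comp hslice
  have hb : ContDiff ℝ 1 (ubar t) := (hub.of_le one_le).comp hslice
  have key := neg_setIntegral_Q_mul_vdiv_le hd hr hs ha hb hpr hps hpa hpb
    (fun x => (hpos t ht x).1) (fun x => (hpos t ht x).2)
  have htime : ∀ x, ContDiff ℝ 1 fun s : ℝ => (s, x) := fun x : E d => contDiff_prodMk_left x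
  have hderiv : ∀ x, deriv (fun s => (ρ s x - ρbar s x) ^ 2) t
      = -2 * ((ρ t x - ρbar t x) * (vdiv (fun y => ρ t y • u t y) x
          - vdiv (fun y => ρbar t y • ubar t y) x)) := fun x => by
    have d1 : DifferentiableAt ℝ (fun s => ρ s x) t :=
      (hρ.comp (htime x)).differentiable one_ne_zero t
    have d2 : DifferentiableAt ℝ (fun s => ρbar s x) t :=
      (hρb.comp (htime x)).differentiable one_ne_zero t
    have e1 : deriv (fun s => ρ s x) t + vdiv (fun y => ρ t y • u t y) x = 0 := hm t ht x
    have e2 : deriv (fun s => ρbar s x) t + vdiv (fun y => ρbar t y • ubar t y) x = 0 :=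
      hmb t ht x
    have h := ((d1.hasDerivAt.sub d2.hasDerivAt).pow 2).deriv
    rw [eq_neg_of_add_eq_zero_left e1, eq_neg_of_add_eq_zero_left e2] at h
    refine Eq.trans h ?_
    simp only [Pi.sub_apply]
    push_cast
    ring
  have hI := hasDerivAt_setIntegral_Q (f := fun s x => (ρ s x - ρbar s x) ^ 2)
    ((hρ.sub hρb).pow 2) t
  simp only [hderiv, integral_const_mul] at hI
  have hI0 : ∀ s, 0 ≤ ∫ x in Q d, (ρ s x - ρbar s x) ^ 2 :=
    fun s => integral_nonneg fun x => sq_nonneg _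
  rcases (hI0 t).eq_or_lt with h0 | h0
  · have hmin : IsLocalMin (fun s => (∫ x in Q d, (ρ s x - ρbar s x) ^ 2) ^ (1 / 2 : ℝ)) t :=
      .of_forall fun s => by
        simp only [← h0]
        rw [Real.zero_rpow (by norm_num)]
        exact Real.rpow_nonneg (hI0 s) _
    rw [hmin.deriv_eq_zero]
    have hρ0 : 0 ≤ ⨆ x, ρ t x := Real.iSup_nonneg fun x => (hpos t ht x).1
    have hρb0 : 0 ≤ ⨆ x, ρbar t x := Real.iSup_nonneg fun x => (hpos t ht x).2
    have hB0 : 0 ≤ ⨆ x, ‖fderiv ℝ (ubar t) x‖ := Real.iSup_nonneg fun x => norm_nonneg _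
    have hG0 : 0 ≤ ∫ x in Q d, gradsq (fun y => u t y - ubar t y) x :=
      integral_nonneg fun x => Finset.sum_nonneg fun i _ => sq_nonneg _
    positivity
  · have hsqrt := hI.sqrt h0.ne'
    simp only [Real.sqrt_eq_rpow] at hsqrt
    rw [hsqrt.deriv, div_le_iff₀ (by positivity)]
    linarith

end
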